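/- arXiv:2603.09475 — 2 statements merged into one kernel-verified Lean document; each statement's English description precedes it below -/
import Mathlib

section
/- Theorem 1(b): For every finite simple graph G, G belongs to the class C_{S,S̄} (i.e., for every T ⊆ V satisfying both conditions S and S̄, G admits an acyclic T-odd orientation) if and only if G has at most 2 vertices. -/
open SimpleGraph

section Defs

variable {V : Type*}

/-- An orientation of a simple graph: each edge gets exactly one direction. -/
structure GraphOrientation {V : Type*} (G : SimpleGraph V) where
  dir : V → V → Prop
  dir_adj : ∀ u v, dir u v → G.Adj u v
  dir_choice : ∀ u v, G.Adj u v → (dir u v ↔ ¬ dir v u)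

/-- An orientation is acyclic if there is no directed cycle, i.e. the transitive
closure of the arc relation is irreflexive. -/
def GraphOrientation.Acyclic {G : SimpleGraph V} (o : GraphOrientation G) : Prop :=
  Irreflexive (Relation.TransGen o.dir)

/-- In-degree of a vertex in an orientation. -/
noncomputable def GraphOrientation.indeg {G : SimpleGraph V} (o : GraphOrientation G)
    (v : V) : ℕ :=
  Set.ncard {u | o.dir u v}

/-- An orientation is `T`-odd if a vertex has odd in-degree iff it belongs to `T`. -/
def GraphOrientation.IsTOdd {G : SimpleGraph V} (o : GraphOrientation G) (T : Set V) : Prop :=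
  ∀ v, Odd (o.indeg v) ↔ v ∈ T

/-- `G` admits an acyclic `T`-odd orientation. -/
def HasAcyclicTOddOrientation (G : SimpleGraph V) (T : Set V) : Prop :=
  ∃ o : GraphOrientation G, o.Acyclic ∧ o.IsTOdd T

/-- Degree of a vertex. -/
noncomputable def vdeg (G : SimpleGraph V) (v : V) : ℕ := (G.neighborSet v).ncard

/-- Potential sources: `V \ T`. -/
def sourceSet (T : Set V) : Set V := Tᶜ

/-- Potential sinks. -/
def sinkSet (G : SimpleGraph V) (T : Set V) : Set V :=
  {v | (v ∈ T ∧ Odd (vdeg G v)) ∨ (v ∉ T ∧ Even (vdeg G v))}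

/-- Parity condition `𝒫`: `|E| + |T|` is even. -/
def CondP (G : SimpleGraph V) (T : Set V) : Prop :=
  Even (G.edgeSet.ncard + T.ncard)

/-- Source condition `𝒮`. -/
def CondS (G : SimpleGraph V) (T : Set V) : Prop :=
  (sourceSet T).Nonempty ∧
    ((sourceSet T).ncard = 1 → Nat.card V = 1 ∨ sourceSet T ≠ sinkSet G T)

/-- Sink condition `𝒮̄`. -/
def CondSbar (G : SimpleGraph V) (T : Set V) : Prop :=
  (sinkSet G T).Nonempty ∧
    ((sinkSet G T).ncard = 1 → Nat.card V = 1 ∨ sinkSet G T ≠ sourceSet T)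

/-- Membership in the class `C_P`. -/
def MemCP (G : SimpleGraph V) : Prop :=
  ∀ T : Set V, CondP G T → HasAcyclicTOddOrientation G T

/-- Membership in the class `C_{P,S}`. -/
def MemCPS (G : SimpleGraph V) : Prop :=
  ∀ T : Set V, CondP G T → CondS G T → HasAcyclicTOddOrientation G T

/-- Membership in the class `C_{P,S̄}`. -/
def MemCPSbar (G : SimpleGraph V) : Prop :=
  ∀ T : Set V, CondP G T → CondSbar G T → HasAcyclicTOddOrientation G T

/-- Membership in the class `C_{P,S,S̄}`. -/
def MemCPSSbar (G : SimpleGraph V) : Prop :=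
  ∀ T : Set V, CondP G T → CondS G T → CondSbar G T → HasAcyclicTOddOrientation G T

/-- A graph is Eulerian if it is connected and every vertex has even degree. -/
def IsEulerianGraph (G : SimpleGraph V) : Prop :=
  G.Connected ∧ ∀ v : V, Even (vdeg G v)

end Defs

namespace GraphOrientation

variable {V : Type*} [Fintype V] {G : SimpleGraph V}

open Classical in
lemma two_mul_sum_indeg (o : GraphOrientation G) :
    2 * ∑ v, o.indeg v = ∑ u, ∑ v, if G.Adj u v then 1 else 0 := by
  have hin : ∑ v, o.indeg v = ∑ v, ∑ u, if o.dir u v then 1 else 0 := by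
    refine Finset.sum_congr rfl fun v _ => ?_
    rw [indeg, Set.ncard_eq_toFinset_card', Set.toFinset_ofPred, Finset.card_filter]
  have hswap := hin.trans Finset.sum_comm
  rw [two_mul]
  nth_rewrite 1 [hin]
  rw [hswap, ← Finset.sum_add_distrib]
  refine Finset.sum_congr rfl fun u _ => ?_
  rw [← Finset.sum_add_distrib]
  refine Finset.sum_congr rfl fun v _ => ?_
  have h₁ := o.dir_adj u v
  have h₂ := o.dir_adj v u
  have h₃ := o.dir_choice u v
  have h₄ := G.adj_comm u v
  split_ifs <;> tauto

lemma sum_indeg_eq (o o' : GraphOrientation G) :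
    ∑ v, o.indeg v = ∑ v, o'.indeg v := by
  have h := o.two_mul_sum_indeg.trans o'.two_mul_sum_indeg.symm
  lia

lemma IsTOdd.odd_sum_indeg_iff {o : GraphOrientation G} {T : Set V} (h : o.IsTOdd T) :
    Odd (∑ v, o.indeg v) ↔ Odd T.ncard := by
  classical
  rw [Finset.odd_sum_iff_odd_card_odd, Set.ncard_eq_toFinset_card']
  have hT : Finset.univ.filter (fun v => Odd (o.indeg v)) = T.toFinset := by
    ext v
    simpa using h v
  rw [hT]

end GraphOrientation

section

variable {V : Type*} {G : SimpleGraph V}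

lemma HasAcyclicTOddOrientation.odd_ncard_iff [Fintype V] {S T : Set V}
    (hS : HasAcyclicTOddOrientation G S) (hT : HasAcyclicTOddOrientation G T) :
    Odd S.ncard ↔ Odd T.ncard := by
  obtain ⟨o, -, ho⟩ := hS
  obtain ⟨o', -, ho'⟩ := hT
  rw [← ho.odd_sum_indeg_iff, ← ho'.odd_sum_indeg_iff, o.sum_indeg_eq o']

lemma sourceSet_compl (A : Set V) : sourceSet Aᶜ = A := compl_compl A

lemma mem_sinkSet_compl {A : Set V} {v : V} :
    v ∈ sinkSet G Aᶜ ↔ (v ∈ A ↔ ¬ Odd (vdeg G v)) := by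
  simp only [sinkSet, Set.mem_ofPred_eq, Set.mem_compl_iff, ← Nat.not_odd_iff_even]
  tauto

lemma condS_and_condSbar_compl {A : Set V} (hA : A.Nonempty) (hne : A ≠ {v | Odd (vdeg G v)})
    (hcard : A.ncard = 1 → ∃ v, Odd (vdeg G v)) : CondS G Aᶜ ∧ CondSbar G Aᶜ := by
  have key : A.ncard = 1 → A ≠ sinkSet G Aᶜ := by
    intro h heq
    obtain ⟨v, hv⟩ := hcard h
    have hiff : v ∈ A ↔ v ∈ sinkSet G Aᶜ := by rw [← heq]
    rw [mem_sinkSet_compl] at hiff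
    tauto
  have hsink : (sinkSet G Aᶜ).Nonempty := by
    by_contra! h
    refine hne (Set.ext fun v => ?_)
    have hv : v ∉ sinkSet G Aᶜ := by simp [h]
    rw [mem_sinkSet_compl] at hv
    simp only [Set.mem_ofPred_eq]
    tauto
  rw [CondS, CondSbar, sourceSet_compl]
  exact ⟨⟨hA, fun h => Or.inr (key h)⟩,
    hsink, fun h => Or.inr fun heq => key (heq ▸ h) heq.symm⟩

lemma exists_ncard_eq_one_ne {a b : V} (hab : a ≠ b) (O : Set V) :
    ∃ A : Set V, A.ncard = 1 ∧ A ≠ O := by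
  by_cases h : ({a} : Set V) = O
  · refine ⟨{b}, Set.ncard_singleton b, ?_⟩
    rw [← h]
    simpa using hab.symm
  · exact ⟨{a}, Set.ncard_singleton a, h⟩

lemma exists_ncard_eq_two_ne {a b c : V} (hab : a ≠ b) (hac : a ≠ c) (hbc : b ≠ c)
    (O : Set V) : ∃ A : Set V, A.ncard = 2 ∧ A ≠ O := by
  by_cases h : ({a, b} : Set V) = O
  · refine ⟨{a, c}, Set.ncard_pair hac, ?_⟩
    rw [← h]
    intro heq
    have hc : c ∈ ({a, b} : Set V) := heq ▸ by simp
    grind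
  · exact ⟨{a, b}, Set.ncard_pair hab, h⟩

lemma card_le_two_of_hasAcyclicTOddOrientation [Fintype V]
    (h : ∀ T : Set V, CondS G T → CondSbar G T → HasAcyclicTOddOrientation G T) :
    Fintype.card V ≤ 2 := by
  by_contra! hV
  obtain ⟨a, b, c, hab, hac, hbc⟩ := Fintype.two_lt_card_iff.mp hV
  have orient : ∀ A : Set V, A.ncard ≠ 0 → A ≠ {v | Odd (vdeg G v)} →
      (A.ncard = 1 → ∃ v, Odd (vdeg G v)) → HasAcyclicTOddOrientation G Aᶜ := by
    intro A hA hne hcard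
    obtain ⟨h₁, h₂⟩ :=
      condS_and_condSbar_compl (Set.nonempty_of_ncard_ne_zero hA) hne hcard
    exact h _ h₁ h₂
  have parity : ∀ A B : Set V, A.ncard + 1 = B.ncard →
      HasAcyclicTOddOrientation G Aᶜ → HasAcyclicTOddOrientation G Bᶜ → False := by
    intro A B hAB hA hB
    have hodd := hA.odd_ncard_iff hB
    have h₁ := Set.ncard_add_ncard_compl A
    have h₂ := Set.ncard_add_ncard_compl B
    rw [Nat.odd_iff, Nat.odd_iff] at hodd
    lia
  obtain ⟨B, hB, hBne⟩ := exists_ncard_eq_two_ne hab hac hbc {v | Odd (vdeg G v)}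
  have hBo := orient B (by lia) hBne (by lia)
  by_cases hO : ∃ v, Odd (vdeg G v)
  · obtain ⟨A, hA, hAne⟩ := exists_ncard_eq_one_ne hab {v | Odd (vdeg G v)}
    exact parity A B (by lia) (orient A (by lia) hAne fun _ => hO) hBo
  · have hC : ({a, b, c} : Set V).ncard = 3 := Set.ncard_eq_three.mpr ⟨a, b, c, hab, hac, hbc, rfl⟩
    refine parity B _ (by lia) hBo (orient {a, b, c} (by lia) ?_ (by lia))
    intro heq
    have ha : a ∈ {v | Odd (vdeg G v)} := heq ▸ by simp
    exact hO ⟨a, ha⟩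

lemma hasAcyclicTOddOrientation_bot_empty :
    HasAcyclicTOddOrientation (⊥ : SimpleGraph V) ∅ := by
  refine ⟨⟨fun _ _ => False, by simp, by simp⟩, ?_, ?_⟩
  · intro v hv
    obtain ⟨_, _, h⟩ := Relation.TransGen.tail'_iff.mp hv
    exact h
  · intro v
    simp [GraphOrientation.indeg]

lemma eq_empty_of_condS_bot [Fintype V] (hV : Fintype.card V ≤ 2) {T : Set V}
    (hS : CondS (⊥ : SimpleGraph V) T) : T = ∅ := by
  have hsink : sinkSet (⊥ : SimpleGraph V) T = sourceSet T := by
    ext v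
    simp [sinkSet, sourceSet, vdeg]
  obtain ⟨hne, hcard⟩ := hS
  rw [hsink] at hcard
  have h₁ : T.ncard + (sourceSet T).ncard = Nat.card V := Set.ncard_add_ncard_compl T
  have h₂ : 0 < (sourceSet T).ncard := hne.ncard_pos
  rw [← Nat.card_eq_fintype_card] at hV
  rw [← Set.ncard_eq_zero]
  grind

lemma hasAcyclicTOddOrientation_of_adj {a b : V} (hab : G.Adj a b)
    (huniv : ∀ v, v = a ∨ v = b) {T : Set V} (ha : a ∉ T) (hb : b ∈ T) :
    HasAcyclicTOddOrientation G T := by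
  have hne := hab.ne
  refine ⟨⟨fun u v => u = a ∧ v = b, ?_, ?_⟩, ?_, ?_⟩
  · rintro u v ⟨rfl, rfl⟩
    exact hab
  · intro u v huv
    have huv := huv.ne
    have hu := huniv u
    have hv := huniv v
    grind
  · have hend : ∀ u v, Relation.TransGen (fun u v => u = a ∧ v = b) u v → u = a ∧ v = b := by
      intro u v h
      induction h <;> grind
    intro v hv
    have := hend v v hv
    grind
  · intro v
    rcases huniv v with rfl | rfl
    · simp [GraphOrientation.indeg, hne, ha]
    · simp [GraphOrientation.indeg, hb]

lemma vdeg_eq_one_of_adj {a b : V} (hab : G.Adj a b) (huniv : ∀ v, v = a ∨ v = b) :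
    vdeg G a = 1 := by
  rw [vdeg, Set.ncard_eq_one]
  refine ⟨b, Set.ext fun v => ?_⟩
  rcases huniv v with rfl | rfl
  · simp [hab.ne]
  · simp [hab]

lemma hasAcyclicTOddOrientation_of_card_le_two [Fintype V] (hV : Fintype.card V ≤ 2)
    {T : Set V} (hS : CondS G T) (hSbar : CondSbar G T) : HasAcyclicTOddOrientation G T := by
  by_cases hG : G = ⊥
  · subst hG
    rw [eq_empty_of_condS_bot hV hS]
    exact hasAcyclicTOddOrientation_bot_empty
  obtain ⟨a, b, hab⟩ := SimpleGraph.ne_bot_iff_exists_adj.mp hG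
  have huniv : ∀ v, v = a ∨ v = b := by
    by_contra! ⟨c, hca, hcb⟩
    have := Fintype.two_lt_card_iff.mpr ⟨c, a, b, hca, hcb, hab.ne⟩
    lia
  have hda := vdeg_eq_one_of_adj hab huniv
  have hdb := vdeg_eq_one_of_adj hab.symm fun v => (huniv v).symm
  obtain ⟨x, hx⟩ : ∃ x, x ∉ T := hS.1
  obtain ⟨y, hy⟩ : ∃ y, y ∈ T := by
    obtain ⟨y, hy⟩ := hSbar.1
    refine ⟨y, ?_⟩
    rcases huniv y with rfl | rfl <;> simpa [sinkSet, hda, hdb] using hy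
  by_cases ha : a ∈ T
  · have hb : b ∉ T := by
      rcases huniv x with rfl | rfl
      · exact absurd ha hx
      · exact hx
    exact hasAcyclicTOddOrientation_of_adj hab.symm (fun v => (huniv v).symm) hb ha
  · have hb : b ∈ T := by
      rcases huniv y with rfl | rfl
      · exact absurd hy ha
      · exact hy
    exact hasAcyclicTOddOrientation_of_adj hab huniv ha hb

end

/-- Theorem 1(b): `C_{S,S̄}` consists exactly of the graphs with at most two vertices. -/
theorem thm_b {V : Type*} [Fintype V] [Nonempty V] (G : SimpleGraph V) :
    (∀ T : Set V, CondS G T → CondSbar G T → HasAcyclicTOddOrientation G T) ↔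
      Fintype.card V ≤ 2 := by
  exact ⟨card_le_two_of_hasAcyclicTOddOrientation,
    fun hV _ hS hSbar => hasAcyclicTOddOrientation_of_card_le_two hV hS hSbar⟩
end

section
/- Theorem 1(d): For every finite simple graph G, the following are equivalent: (i) G ∈ C_{P,S} \ C_P; (ii) G ∈ C_{P,S̄} \ C_P; (iii) either G is edgeless with exactly 2 or exactly 3 vertices, or G ∈ C_{P,S,S̄} \ C_P and G is Eulerian. -/
open SimpleGraph

section Orientations

variable {V : Type*} {G : SimpleGraph V}

/-- The orientation with all arcs reversed. -/
def GraphOrientation.reverse (o : GraphOrientation G) : GraphOrientation G where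
  dir u v := o.dir v u
  dir_adj u v h := (o.dir_adj v u h).symm
  dir_choice u v h := o.dir_choice v u h.symm

theorem GraphOrientation.Acyclic.reverse {o : GraphOrientation G} (h : o.Acyclic) :
    o.reverse.Acyclic := fun v hv => h v (Relation.transGen_swap.mp hv)

theorem GraphOrientation.indeg_add_indeg_reverse [Finite V] (o : GraphOrientation G) (v : V) :
    o.indeg v + o.reverse.indeg v = vdeg G v := by
  have hunion : G.neighborSet v = {u | o.dir u v} ∪ {u | o.dir v u} := by
    ext u
    simp only [mem_neighborSet, Set.mem_union, Set.mem_ofPred_eq]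
    constructor
    · intro h
      have := o.dir_choice v u h
      tauto
    · rintro (h | h)
      · exact (o.dir_adj _ _ h).symm
      · exact o.dir_adj _ _ h
  have hdisj : Disjoint {u | o.dir u v} {u | o.dir v u} :=
    Set.disjoint_left.mpr fun u h h' => (o.dir_choice u v (o.dir_adj _ _ h)).mp h h'
  unfold vdeg
  rw [hunion, Set.ncard_union_eq hdisj (Set.toFinite _) (Set.toFinite _)]
  rfl

theorem sinkSet_compl_sinkSet (T : Set V) : sinkSet G (sinkSet G T)ᶜ = sourceSet T := by
  ext v
  have := Nat.not_even_iff_odd (n := vdeg G v)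
  simp only [sinkSet, sourceSet, Set.mem_compl_iff, Set.mem_ofPred_eq]
  tauto

theorem HasAcyclicTOddOrientation.compl_sinkSet [Finite V] {T : Set V}
    (h : HasAcyclicTOddOrientation G T) : HasAcyclicTOddOrientation G (sinkSet G T)ᶜ := by
  obtain ⟨o, ho, hT⟩ := h
  refine ⟨o.reverse, ho.reverse, fun v => ?_⟩
  have hv := hT v
  have hsum := o.indeg_add_indeg_reverse v
  simp only [sinkSet, Set.mem_compl_iff, Set.mem_ofPred_eq]
  rw [← hv, ← hsum]
  simp only [← Nat.not_odd_iff_even, Nat.odd_add]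
  tauto

theorem compl_sinkSet_compl_sinkSet (T : Set V) : (sinkSet G (sinkSet G T)ᶜ)ᶜ = T := by
  rw [sinkSet_compl_sinkSet, sourceSet, compl_compl]

theorem even_ncard_setOf_odd_vdeg [Finite V] : Even {v | Odd (vdeg G v)}.ncard := by
  classical
  have := Fintype.ofFinite V
  have h := G.even_card_odd_degree_vertices
  have hdeg (v : V) : vdeg G v = G.degree v := by
    rw [vdeg, Set.ncard_eq_toFinset_card']
    rfl
  rw [Set.ncard_eq_toFinset_card']
  simpa [hdeg] using h

theorem CondP.compl_sinkSet [Finite V] {T : Set V} (h : CondP G T) :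
    CondP G (sinkSet G T)ᶜ := by
  set O : Set V := {v | Odd (vdeg G v)} with hO
  have heven : Even O.ncard := even_ncard_setOf_odd_vdeg
  have hset : (sinkSet G T)ᶜ = (T \ O) ∪ (O \ T) := by
    ext v
    have := Nat.not_even_iff_odd (n := vdeg G v)
    simp only [sinkSet, hO, Set.mem_compl_iff, Set.mem_ofPred_eq, Set.mem_union, Set.mem_sdiff]
    tauto
  have hdisj : Disjoint (T \ O) (O \ T) :=
    Set.disjoint_left.mpr fun v h h' => h'.2 h.1
  have hcard := Set.ncard_union_eq hdisj (Set.toFinite _) (Set.toFinite _)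
  have h₁ := Set.ncard_inter_add_ncard_sdiff_eq_ncard T O (Set.toFinite _)
  have h₂ := Set.ncard_inter_add_ncard_sdiff_eq_ncard O T (Set.toFinite _)
  rw [Set.inter_comm O T] at h₂
  unfold CondP at h ⊢
  rw [hset, hcard]
  rw [Nat.even_iff] at *
  omega

theorem condS_compl_sinkSet {T : Set V} : CondS G (sinkSet G T)ᶜ ↔ CondSbar G T := by
  unfold CondS CondSbar
  rw [sinkSet_compl_sinkSet, show sourceSet (sinkSet G T)ᶜ = sinkSet G T from compl_compl _]

theorem memCPS_iff_memCPSbar [Finite V] : MemCPS G ↔ MemCPSbar G := by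
  constructor
  · intro h T hP hS
    simpa only [compl_sinkSet_compl_sinkSet] using
      (h _ hP.compl_sinkSet (condS_compl_sinkSet.mpr hS)).compl_sinkSet
  · intro h T hP hS
    simpa only [compl_sinkSet_compl_sinkSet] using
      (h _ hP.compl_sinkSet (condS_compl_sinkSet.mp
        (by rwa [compl_sinkSet_compl_sinkSet]))).compl_sinkSet

theorem sinkSet_eq_sourceSet_iff {T : Set V} :
    sinkSet G T = sourceSet T ↔ ∀ v, Even (vdeg G v) := by
  simp only [sinkSet, sourceSet, Set.ext_iff, Set.mem_ofPred_eq, Set.mem_compl_iff]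
  refine forall_congr' fun v => ?_
  rw [← Nat.not_even_iff_odd]
  tauto

theorem MemCPS.even_vdeg [Finite V] (h : MemCPS G) (hP : ¬ MemCP G) (v : V) :
    Even (vdeg G v) := by
  have h' := memCPS_iff_memCPSbar.mp h
  unfold MemCP at hP
  push Not at hP
  obtain ⟨T, hT, hno⟩ := hP
  have hS : ¬ CondS G T := fun hS => hno (h T hT hS)
  have hSbar : ¬ CondSbar G T := fun hS => hno (h' T hT hS)
  suffices sinkSet G T = sourceSet T from sinkSet_eq_sourceSet_iff.mp this v
  unfold CondS at hS
  unfold CondSbar at hSbar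
  by_cases hso : (sourceSet T).Nonempty
  · have : (sourceSet T) = sinkSet G T := by tauto
    exact this.symm
  · by_cases hsi : (sinkSet G T).Nonempty
    · tauto
    · rw [Set.not_nonempty_iff_eq_empty] at hso hsi
      rw [hso, hsi]

/-- Over a set closed under adjacency, the in-degrees sum to half of the degrees. -/
theorem GraphOrientation.two_mul_sum_indeg_s3 [Fintype V] (o : GraphOrientation G) (K : Finset V)
    (hK : ∀ u v, G.Adj u v → (u ∈ K ↔ v ∈ K)) :
    2 * ∑ v ∈ K, o.indeg v = ∑ v ∈ K, vdeg G v := by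
  classical
  have hin (o : GraphOrientation G) : ∀ v ∈ K,
      o.indeg v = ∑ u ∈ K, if o.dir u v then 1 else 0 := by
    intro v hv
    rw [Finset.sum_boole, Nat.cast_id, GraphOrientation.indeg, ← Set.ncard_coe_finset]
    congr 1
    ext u
    simp only [Set.mem_ofPred_eq, Finset.coe_filter]
    exact ⟨fun h => ⟨(hK u v (o.dir_adj u v h)).mpr hv, h⟩, fun h => h.2⟩
  have hrev : ∑ v ∈ K, o.reverse.indeg v = ∑ v ∈ K, o.indeg v := by
    rw [Finset.sum_congr rfl (hin o), Finset.sum_congr rfl (hin o.reverse), Finset.sum_comm]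
    rfl
  calc
    2 * ∑ v ∈ K, o.indeg v = ∑ v ∈ K, o.indeg v + ∑ v ∈ K, o.reverse.indeg v := by
      rw [hrev, two_mul]
    _ = ∑ v ∈ K, vdeg G v := by
      rw [← Finset.sum_add_distrib]
      exact Finset.sum_congr rfl fun v _ => o.indeg_add_indeg_reverse v

theorem reachable_of_hasAcyclicTOddOrientation [Finite V] {R : Set V} {a b : V}
    (ha : a ∉ R) (hab : a ≠ b)
    (hTa : HasAcyclicTOddOrientation G (insert a R))
    (hTb : HasAcyclicTOddOrientation G (insert b R)) : G.Reachable a b := by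
  classical
  have := Fintype.ofFinite V
  by_contra hreach
  obtain ⟨o, -, ho⟩ := hTa
  obtain ⟨o', -, ho'⟩ := hTb
  let K : Finset V := {v | G.Reachable a v}
  have hK : ∀ u v, G.Adj u v → (u ∈ K ↔ v ∈ K) := by
    intro u v huv
    simp only [K, Finset.mem_filter, Finset.mem_univ, true_and]
    exact ⟨fun h => h.trans huv.reachable, fun h => h.trans huv.symm.reachable⟩
  have h₁ := o.two_mul_sum_indeg_s3 K hK
  have h₂ := o'.two_mul_sum_indeg_s3 K hK
  have haK : a ∈ K := by simp [K]
  have hsum : ∑ v ∈ K, (o.indeg v + o'.indeg v) = 2 * ∑ v ∈ K, o.indeg v := by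
    rw [Finset.sum_add_distrib]
    omega
  rw [← Finset.add_sum_erase K _ haK] at hsum
  have hrest : Even (∑ v ∈ K.erase a, (o.indeg v + o'.indeg v)) := by
    refine Finset.even_sum _ fun v hv => ?_
    rw [Finset.mem_erase] at hv
    have hvb : v ≠ b := by
      rintro rfl
      exact hreach (by simpa [K] using hv.2)
    have e₁ := ho v
    have e₂ := ho' v
    rw [Set.mem_insert_iff] at e₁ e₂
    rw [Nat.even_add, ← Nat.not_odd_iff_even, ← Nat.not_odd_iff_even]
    have := hv.1
    tauto
  have hoa : Odd (o.indeg a) := (ho a).mpr (Set.mem_insert _ _)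
  have hoa' : ¬ Odd (o'.indeg a) := by
    rw [ho' a, Set.mem_insert_iff]
    tauto
  rw [Nat.odd_iff] at hoa hoa'
  rw [Nat.even_iff] at hrest
  omega

theorem condS_of_one_lt_ncard {T : Set V} (h : 1 < (sourceSet T).ncard) : CondS G T :=
  ⟨Set.nonempty_of_ncard_ne_zero (by omega), fun h' => by omega⟩

theorem MemCPS.reachable [Finite V] (h : MemCPS G) {a b : V} (hab : a ≠ b) {m : ℕ}
    (hm : m + 3 ≤ Nat.card V) (hodd : Odd (G.edgeSet.ncard + m)) : G.Reachable a b := by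
  have hpair : ({a, b} : Set V)ᶜ.ncard = Nat.card V - 2 := by
    rw [Set.ncard_compl, Set.ncard_pair hab]
  obtain ⟨R, hR, hRm⟩ := Set.exists_subset_card_eq (s := ({a, b} : Set V)ᶜ) (n := m) (by omega)
  have haR : a ∉ R := fun h => hR h (by simp)
  have hbR : b ∉ R := fun h => hR h (by simp)
  have key (c : V) (hc : c ∉ R) : HasAcyclicTOddOrientation G (insert c R) := by
    have hcard := Set.ncard_insert_of_notMem hc (Set.toFinite R)
    refine h _ ?_ (condS_of_one_lt_ncard ?_)
    · unfold CondP
      rw [hcard, hRm, ← add_assoc]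
      exact hodd.add_one
    · rw [sourceSet, Set.ncard_compl, hcard]
      omega
  exact reachable_of_hasAcyclicTOddOrientation haR hab (key a haR) (key b hbR)

theorem connected_of_even_vdeg [Finite V] [Nonempty V] (heven : ∀ v, Even (vdeg G v))
    (hcard : Nat.card V ≤ 3) (hne : G.edgeSet ≠ ∅) : G.Connected := by
  rw [Ne, edgeSet_eq_empty, ← Ne, ne_bot_iff_exists_adj] at hne
  obtain ⟨u, w, huw⟩ := hne
  have hpos : 0 < vdeg G u := (Set.ncard_pos (Set.toFinite _)).mpr ⟨w, huw⟩
  obtain ⟨k, hk⟩ := heven u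
  have hu : u ∉ G.neighborSet u := by simp
  have hins := Set.ncard_insert_of_notMem hu (Set.toFinite _)
  have huniv : insert u (G.neighborSet u) = Set.univ := by
    refine Set.eq_of_subset_of_ncard_le (Set.subset_univ _) ?_
    rw [Set.ncard_univ]
    unfold vdeg at hk hpos
    omega
  refine (connected_iff_exists_forall_reachable G).mpr ⟨u, fun v => ?_⟩
  rcases (huniv ▸ Set.mem_univ v : v ∈ insert u (G.neighborSet u)) with rfl | hv
  · exact Reachable.refl _
  · exact Adj.reachable hv

theorem MemCPS.connected_or_edgeSet_eq_empty [Finite V] [Nonempty V] (h : MemCPS G)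
    (heven : ∀ v, Even (vdeg G v)) :
    G.Connected ∨ (G.edgeSet = ∅ ∧ (Nat.card V = 2 ∨ Nat.card V = 3)) := by
  rw [or_iff_not_imp_left]
  intro hconn
  obtain ⟨a, b, hab⟩ : ∃ a b, ¬ G.Reachable a b := by
    by_contra! hall
    exact hconn ⟨hall⟩
  have hne : a ≠ b := by
    rintro rfl
    exact hab (Reachable.refl _)
  have hlt : Nat.card V ≤ 3 := by
    by_contra! hlt
    rcases Nat.even_or_odd (G.edgeSet.ncard + (Nat.card V - 4)) with hpar | hpar
    · refine hab (h.reachable hne (m := Nat.card V - 3) (by omega) ?_)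
      rw [Nat.odd_iff]
      rw [Nat.even_iff] at hpar
      omega
    · exact hab (h.reachable hne (by omega) hpar)
  have htwo : 1 < Nat.card V := Finite.one_lt_card_iff_nontrivial.mpr ⟨a, b, hne⟩
  refine ⟨?_, by omega⟩
  by_contra hE
  exact hconn (connected_of_even_vdeg heven hlt hE)

theorem hasAcyclicTOddOrientation_iff_of_edgeSet_eq_empty (hE : G.edgeSet = ∅) {T : Set V} :
    HasAcyclicTOddOrientation G T ↔ T = ∅ := by
  rw [edgeSet_eq_empty] at hE
  subst hE
  constructor
  · rintro ⟨o, -, ho⟩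
    refine Set.eq_empty_of_forall_notMem fun v hv => ?_
    have hempty : {u | o.dir u v} = ∅ :=
      Set.eq_empty_of_forall_notMem fun u hu => o.dir_adj u v hu
    have := (ho v).mpr hv
    rw [GraphOrientation.indeg, hempty, Set.ncard_empty] at this
    exact absurd this (by decide)
  · rintro rfl
    refine ⟨⟨fun _ _ => False, fun _ _ h => h.elim, fun _ _ h => h.elim⟩, fun v hv => ?_,
      fun v => ?_⟩
    · obtain ⟨_, -, h⟩ := Relation.TransGen.tail'_iff.mp hv
      exact h
    · simp [GraphOrientation.indeg]

theorem memCPS_of_edgeSet_eq_empty [Finite V] (hE : G.edgeSet = ∅)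
    (hcard : Nat.card V = 2 ∨ Nat.card V = 3) : MemCPS G ∧ ¬ MemCP G := by
  constructor
  · intro T hP hS
    rw [hasAcyclicTOddOrientation_iff_of_edgeSet_eq_empty hE]
    have heven : ∀ v, Even (vdeg G v) := by
      intro v
      rw [edgeSet_eq_empty] at hE
      subst hE
      simp [vdeg]
    obtain ⟨hpos, hone⟩ := hS
    rw [← Set.ncard_pos (Set.toFinite _)] at hpos
    rw [← sinkSet_eq_sourceSet_iff (T := T)] at heven
    have hone' : (sourceSet T).ncard ≠ 1 := by
      intro h
      rcases hone h with h | h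
      · omega
      · exact h heven.symm
    have hsum : T.ncard + (sourceSet T).ncard = Nat.card V := Set.ncard_add_ncard_compl T
    unfold CondP at hP
    rw [hE, Set.ncard_empty, zero_add, Nat.even_iff] at hP
    rw [← Set.ncard_eq_zero (Set.toFinite _)]
    omega
  · intro h
    obtain ⟨T, -, hT⟩ := Set.exists_subset_card_eq (s := (Set.univ : Set V)) (n := 2)
      (by rw [Set.ncard_univ]; omega)
    have := h T (by simp [CondP, hE, hT])
    rw [hasAcyclicTOddOrientation_iff_of_edgeSet_eq_empty hE] at this
    simp [this] at hT

theorem MemCPSSbar.memCPS (h : MemCPSSbar G) (heven : ∀ v, Even (vdeg G v)) : MemCPS G := by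
  intro T hP hS
  refine h T hP hS ?_
  have heq := (sinkSet_eq_sourceSet_iff (T := T)).mpr heven
  unfold CondSbar
  unfold CondS at hS
  rwa [heq] at hS ⊢

theorem memCPS_and_not_memCP_iff [Finite V] [Nonempty V] : (MemCPS G ∧ ¬ MemCP G) ↔
    ((G.edgeSet = ∅ ∧ (Nat.card V = 2 ∨ Nat.card V = 3)) ∨
      (MemCPSSbar G ∧ ¬ MemCP G ∧ IsEulerianGraph G)) := by
  constructor
  · rintro ⟨h, hP⟩
    have heven := h.even_vdeg hP
    rcases h.connected_or_edgeSet_eq_empty heven with hc | hE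
    · exact Or.inr ⟨fun T hT hS _ => h T hT hS, hP, hc, heven⟩
    · exact Or.inl hE
  · rintro (⟨hE, hcard⟩ | ⟨h, hP, hEul⟩)
    · exact memCPS_of_edgeSet_eq_empty hE hcard
    · exact ⟨h.memCPS hEul.2, hP⟩

end Orientations

/-- Theorem 1(d): characterization of `C_{P,S} \ C_P = C_{P,S̄} \ C_P`. -/
theorem thm_d {V : Type*} [Fintype V] [Nonempty V] (G : SimpleGraph V) :
    ((MemCPS G ∧ ¬ MemCP G) ↔
      ((G.edgeSet = ∅ ∧ (Fintype.card V = 2 ∨ Fintype.card V = 3)) ∨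
        (MemCPSSbar G ∧ ¬ MemCP G ∧ IsEulerianGraph G))) ∧
    ((MemCPSbar G ∧ ¬ MemCP G) ↔
      ((G.edgeSet = ∅ ∧ (Fintype.card V = 2 ∨ Fintype.card V = 3)) ∨
        (MemCPSSbar G ∧ ¬ MemCP G ∧ IsEulerianGraph G))) := by
  rw [← memCPS_iff_memCPSbar, ← Nat.card_eq_fintype_card]
  exact ⟨memCPS_and_not_memCP_iff, memCPS_and_not_memCP_iff⟩
end
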